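/- For every bipartite state ρ on ℋ_A ⊗ ℋ_B and every integer k ≥ 1, there exists a k-extendible state ω on ℋ_A ⊗ ℋ_B with ρ ≤ k·ω, and hence S(ρ‖ω) ≤ log₂ k; consequently, inf{S(ρ‖ω) : ω k-extendible} ≤ log₂ k. Moreover, letting E_k(ℋ^{⊗n}) denote the k-extendible states on ℋ_A^{⊗n} ⊗ ℋ_B^{⊗n} (with respect to the bipartition grouping the A copies and the B copies), the regularized quantity E_{E_k}^∞(ρ) := lim_{n→∞} (1/n) inf{S(ρ^{⊗n}‖ω_n) : ω_n ∈ E_k(ℋ^{⊗n})} equals 0 for every state ρ. -/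

import Mathlib

open scoped BigOperators
open Filter ComplexOrder

noncomputable section

namespace GQSL

variable {I : Type*} [Fintype I] [DecidableEq I]

/-- A quantum state: a positive semidefinite matrix of unit trace. -/
def IsState (ρ : Matrix I I ℂ) : Prop := ρ.PosSemidef ∧ ρ.trace = 1

/-- The `n`-fold tensor power of an operator, realized on `Fin n → I` indices. -/
def tpow (ρ : Matrix I I ℂ) (n : ℕ) : Matrix (Fin n → I) (Fin n → I) ℂ :=
  fun x y => ∏ i, ρ (x i) (y i)

/-- Functional calculus for Hermitian matrices (junk value `0` otherwise). -/
def fcal (f : ℝ → ℝ) (A : Matrix I I ℂ) : Matrix I I ℂ :=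
  if hA : A.IsHermitian then
    (hA.eigenvectorUnitary : Matrix I I ℂ) *
      Matrix.diagonal (fun i => (f (hA.eigenvalues i) : ℂ)) *
      star (hA.eigenvectorUnitary : Matrix I I ℂ)
  else 0

/-- Base-2 matrix logarithm, computed on the support. -/
def mlog (A : Matrix I I ℂ) : Matrix I I ℂ :=
  fcal (fun x => if 0 < x then Real.logb 2 x else 0) A

/-- Real matrix power, computed on the support (generalized inverse powers). -/
def mpow (A : Matrix I I ℂ) (t : ℝ) : Matrix I I ℂ :=
  fcal (fun x => if 0 < x then x ^ t else 0) A

/-- Matrix square root of a positive semidefinite matrix. -/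
def msqrt (A : Matrix I I ℂ) : Matrix I I ℂ := fcal Real.sqrt A

/-- Trace norm `‖A‖₁ = tr √(AᴴA)`. -/
def trNorm (A : Matrix I I ℂ) : ℝ := ((msqrt (A.conjTranspose * A)).trace).re

/-- Trace of the positive part of a Hermitian matrix: the sum of its positive eigenvalues. -/
def trPos (A : Matrix I I ℂ) : ℝ := ((fcal (fun x => max x 0) A).trace).re

/-- Fidelity `F(A,B) = tr √(√A B √A)`. -/
def fid (A B : Matrix I I ℂ) : ℝ := ((msqrt (msqrt A * B * msqrt A)).trace).re

/-- Von Neumann entropy (base 2). -/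
def vnEnt (A : Matrix I I ℂ) : ℝ := -((A * mlog A).trace).re

/-- `supp ρ ⊆ supp σ`, expressed via kernels. -/
def SuppLe (ρ σ : Matrix I I ℂ) : Prop := ∀ v, σ.mulVec v = 0 → ρ.mulVec v = 0

/-- Quantum relative entropy `S(ρ‖σ) = tr(ρ(log₂ρ − log₂σ))` (finite-value formula,
meaningful when `SuppLe ρ σ` holds). -/
def relEnt (ρ σ : Matrix I I ℂ) : ℝ := ((ρ * (mlog ρ - mlog σ)).trace).re

/-- `E_M(ρ) = inf {S(ρ‖σ) : σ ∈ M}`; states `σ` violating the support condition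
have `S(ρ‖σ) = +∞` and hence do not contribute to the infimum. -/
def EMset (M : Set (Matrix I I ℂ)) (ρ : Matrix I I ℂ) : ℝ :=
  sInf {x | ∃ σ ∈ M, SuppLe ρ σ ∧ x = relEnt ρ σ}

/-- Max-relative entropy `S_max(ρ‖σ) = inf {s : ρ ≤ 2^s σ}`. -/
def Smax (ρ σ : Matrix I I ℂ) : ℝ := sInf {s : ℝ | (((2:ℝ) ^ s) • σ - ρ).PosSemidef}

/-- Log robustness with respect to a set `M`. -/
def LR (M : Set (Matrix I I ℂ)) (ρ : Matrix I I ℂ) : ℝ :=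
  sInf {x | ∃ σ ∈ M, x = Smax ρ σ}

/-- Smoothed log robustness. -/
def LReps (M : Set (Matrix I I ℂ)) (ε : ℝ) (ρ : Matrix I I ℂ) : ℝ :=
  sInf {x | ∃ ρ', IsState ρ' ∧ trNorm (ρ' - ρ) ≤ ε ∧ x = LR M ρ'}

/-- Partial trace over the `k`-th tensor factor. -/
def ptraceAt {n : ℕ} (k : Fin (n + 1)) (ρ : Matrix (Fin (n + 1) → I) (Fin (n + 1) → I) ℂ) :
    Matrix (Fin n → I) (Fin n → I) ℂ :=
  fun x y => ∑ a : I, ρ (k.insertNth a x) (k.insertNth a y)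

/-- Tensor product of operators on `n` and `m` copies. -/
def tprod {n m : ℕ} (ρ : Matrix (Fin n → I) (Fin n → I) ℂ)
    (ν : Matrix (Fin m → I) (Fin m → I) ℂ) :
    Matrix (Fin (n + m) → I) (Fin (n + m) → I) ℂ :=
  fun x y => ρ (fun i => x (Fin.castAdd m i)) (fun i => y (Fin.castAdd m i)) *
    ν (fun j => x (Fin.natAdd n j)) (fun j => y (Fin.natAdd n j))

/-- Conjugation `P_π ρ P_π†` by the permutation unitary. -/
def permute {n : ℕ} (π : Equiv.Perm (Fin n)) (ρ : Matrix (Fin n → I) (Fin n → I) ℂ) :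
    Matrix (Fin n → I) (Fin n → I) ℂ :=
  fun x y => ρ (x ∘ π) (y ∘ π)

/-- A family of sets of states satisfying properties 1–5, with `σ` the fixed
full-rank state of property 2. -/
structure GoodFamily {d : ℕ} (σ : Matrix (Fin d) (Fin d) ℂ)
    (M : ∀ n : ℕ, Set (Matrix (Fin n → Fin d) (Fin n → Fin d) ℂ)) : Prop where
  states : ∀ n, ∀ ρ ∈ M n, IsState ρ
  convex : ∀ n, Convex ℝ (M n)
  closed : ∀ n, IsClosed (M n)
  sigma_state : IsState σ
  sigma_posdef : σ.PosDef
  sigma_mem : ∀ n, tpow σ n ∈ M n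
  ptrace_mem : ∀ n (k : Fin (n + 1)), ∀ ρ ∈ M (n + 1), ptraceAt k ρ ∈ M n
  tprod_mem : ∀ n m, ∀ ρ ∈ M n, ∀ ν ∈ M m, tprod ρ ν ∈ M (n + m)
  perm_mem : ∀ n (π : Equiv.Perm (Fin n)), ∀ ρ ∈ M n, permute π ρ ∈ M n

/-- The rank-one operator `|f⟩⟨f|`. -/
def vecOp {J : Type*} (f : J → ℂ) : Matrix J J ℂ := fun x y => f x * star (f y)

/-- Squared ℓ²-norm of a vector. -/
def vecNormSq {J : Type*} [Fintype J] (f : J → ℂ) : ℝ := ∑ x, Complex.normSq (f x)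

/-- ℓ²-norm of a vector. -/
def l2norm {J : Type*} [Fintype J] (f : J → ℂ) : ℝ := Real.sqrt (vecNormSq f)

/-- Membership in the symmetric subspace. -/
def IsSymVec {J : Type*} {N : ℕ} (f : (Fin N → J) → ℂ) : Prop :=
  ∀ (π : Equiv.Perm (Fin N)) (x : Fin N → J), f (x ∘ π) = f x

/-- Unnormalized symmetrization `Σ_π P_π ψ`. -/
def symmetrize {J : Type*} {N : ℕ} (ψ : (Fin N → J) → ℂ) : (Fin N → J) → ℂ :=
  fun x => ∑ π : Equiv.Perm (Fin N), ψ (x ∘ π)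

/-- Normalized symmetrization `Sym(ψ)`. -/
def SymOf {J : Type*} [Fintype J] {N : ℕ} (ψ : (Fin N → J) → ℂ) : (Fin N → J) → ℂ :=
  ((l2norm (symmetrize ψ) : ℂ))⁻¹ • symmetrize ψ

/-- Partial trace over the first `m` of `m + k` tensor factors. -/
def ptraceFirst {J : Type*} [Fintype J] [DecidableEq J] {m k : ℕ}
    (ρ : Matrix (Fin (m + k) → J) (Fin (m + k) → J) ℂ) :
    Matrix (Fin k → J) (Fin k → J) ℂ :=
  fun x y => ∑ a : Fin m → J, ρ (Fin.append a x) (Fin.append a y)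

/-- Partial trace over the environment components of `N` system–environment pairs. -/
def ptraceE {A E : Type*} [Fintype A] [Fintype E] {N : ℕ}
    (ρ : Matrix (Fin N → A × E) (Fin N → A × E) ℂ) :
    Matrix (Fin N → A) (Fin N → A) ℂ :=
  fun x y => ∑ e : Fin N → E, ρ (fun i => (x i, e i)) (fun i => (y i, e i))

/-- The set of `(N choose r)`-i.i.d. vectors along `θ`: vectors which are `θ` on
`N − r` of the positions (the permutations of `θ^{⊗(N−r)} ⊗ ψ_r`). -/
def powVecSet {J : Type*} (θ : J → ℂ) (N r : ℕ) : Set ((Fin N → J) → ℂ) :=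
  {f | ∃ S : Finset (Fin N), S.card = N - r ∧
    ∃ ψ : ({i : Fin N // i ∉ S} → J) → ℂ,
      f = fun x => (∏ i ∈ S, θ (x i)) * ψ (fun j => x j.1)}

/-- Almost power states along `θ`: `|θ⟩^{[⊗,N,r]} = Sym(ℋ^{⊗N}) ∩ span V(ℋ^{⊗N}, θ^{⊗N−r})`. -/
def almostPower {J : Type*} (θ : J → ℂ) (N r : ℕ) : Set ((Fin N → J) → ℂ) :=
  {f | IsSymVec f ∧ f ∈ Submodule.span ℂ (powVecSet θ N r)}

/-- `η ⊗ θ^{⊗(N−k)}`: the vector `η` on the first `k` slots and `θ` on the rest. -/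
def etaTensor {J : Type*} {N k : ℕ} (h : k ≤ N) (η : (Fin k → J) → ℂ) (θ : J → ℂ) :
    (Fin N → J) → ℂ :=
  fun x => η (fun i => x (Fin.castLE h i)) * ∏ i : Fin N, if (i : ℕ) < k then 1 else θ (x i)

/-- `η` lies in the `k`-fold tensor power of the orthogonal complement of `θ`:
the contraction of `η` with `⟨θ|` at any slot vanishes. -/
def InPerpPow {J : Type*} [Fintype J] [DecidableEq J] {k : ℕ} (θ : J → ℂ)
    (η : (Fin k → J) → ℂ) : Prop :=
  ∀ (j : Fin k) (z : Fin k → J), ∑ a : J, star (θ a) * η (Function.update z j a) = 0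

/-- Binary Shannon entropy. -/
def binEnt (x : ℝ) : ℝ := -(x * Real.logb 2 x) - (1 - x) * Real.logb 2 (1 - x)

/-- Product operator `σ₁ ⊗ ⋯ ⊗ σ_k` of a `k`-partite system. -/
def prodOp {k : ℕ} {ι : Fin k → Type*} [∀ i, Fintype (ι i)]
    (σs : ∀ i, Matrix (ι i) (ι i) ℂ) : Matrix (∀ i, ι i) (∀ i, ι i) ℂ :=
  fun x y => ∏ i, σs i (x i) (y i)

/-- Separability of a `k`-partite state: a finite convex combination of product states. -/
def IsSeparable {k : ℕ} {ι : Fin k → Type*} [∀ i, Fintype (ι i)]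
    (ρ : Matrix (∀ i, ι i) (∀ i, ι i) ℂ) : Prop :=
  ∃ (m : ℕ) (p : Fin m → ℝ) (σs : Fin m → ∀ i, Matrix (ι i) (ι i) ℂ),
    (∀ j, 0 ≤ p j) ∧ (∑ j, p j = 1) ∧ (∀ j i, IsState (σs j i)) ∧
    ρ = ∑ j, p j • prodOp (σs j)

/-- Relative entropy of entanglement `E_R(ρ) = inf {S(ρ‖ω) : ω separable}`. -/
def ERel {k : ℕ} {ι : Fin k → Type*} [∀ i, Fintype (ι i)] [∀ i, DecidableEq (ι i)]
    (ρ : Matrix (∀ i, ι i) (∀ i, ι i) ℂ) : ℝ :=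
  sInf {x | ∃ ω, IsSeparable ω ∧ SuppLe ρ ω ∧ x = relEnt ρ ω}

/-- `ρ^{⊗n}` of a `k`-partite state, viewed as a `k`-partite state where the `i`-th
party holds the `n` copies of its system. -/
def tpowMulti {k : ℕ} {d : Fin k → ℕ} (ρ : Matrix (∀ i, Fin (d i)) (∀ i, Fin (d i)) ℂ)
    (n : ℕ) : Matrix (∀ i, Fin n → Fin (d i)) (∀ i, Fin n → Fin (d i)) ℂ :=
  fun x y => ∏ t : Fin n, ρ (fun i => x i t) (fun i => y i t)

/-- `ρ^{⊗n}` of a bipartite state in the grouped bipartition `A^{⊗n} : B^{⊗n}`. -/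
def tpowBi {A B : Type*} [Fintype A] [Fintype B]
    (ρ : Matrix (A × B) (A × B) ℂ) (n : ℕ) :
    Matrix ((Fin n → A) × (Fin n → B)) ((Fin n → A) × (Fin n → B)) ℂ :=
  fun x y => ∏ i, ρ (x.1 i, x.2 i) (y.1 i, y.2 i)

/-- `k`-extendibility of a bipartite state. -/
def IsKExtendible {A B : Type*} [Fintype A] [Fintype B] (k : ℕ)
    (σ : Matrix (A × B) (A × B) ℂ) : Prop :=
  ∃ σ' : Matrix (A × (Fin k → B)) (A × (Fin k → B)) ℂ,
    IsState σ' ∧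
    (∀ (π : Equiv.Perm (Fin k)) (p q : A × (Fin k → B)),
      σ' (p.1, p.2 ∘ π) (q.1, q.2 ∘ π) = σ' p q) ∧
    (∀ p q : A × B, σ p q =
      ∑ f : {i : Fin k // (i : ℕ) ≠ 0} → B,
        σ' (p.1, fun i => if h : (i : ℕ) = 0 then p.2 else f ⟨i, h⟩)
           (q.1, fun i => if h : (i : ℕ) = 0 then q.2 else f ⟨i, h⟩))

section Overlap

/-- Squared moduli of the inner products of the eigenvectors of two Hermitian matrices. -/
def eigenOverlap {A B : Matrix I I ℂ} (hA : A.IsHermitian) (hB : B.IsHermitian) (i j : I) : ℝ :=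
  Complex.normSq ((star (hA.eigenvectorUnitary : Matrix I I ℂ) *
    (hB.eigenvectorUnitary : Matrix I I ℂ)) i j)

lemma eigenOverlap_nonneg {A B : Matrix I I ℂ} (hA : A.IsHermitian) (hB : B.IsHermitian)
    (i j : I) : 0 ≤ eigenOverlap hA hB i j :=
  Complex.normSq_nonneg _

lemma fcal_of_isHermitian {A : Matrix I I ℂ} (hA : A.IsHermitian) (f : ℝ → ℝ) :
    fcal f A = (hA.eigenvectorUnitary : Matrix I I ℂ) *
      Matrix.diagonal (fun i => (f (hA.eigenvalues i) : ℂ)) *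
      star (hA.eigenvectorUnitary : Matrix I I ℂ) := by
  rw [fcal, dif_pos hA]

lemma fcal_id {A : Matrix I I ℂ} (hA : A.IsHermitian) : fcal (fun x => x) A = A := by
  rw [fcal_of_isHermitian hA]
  exact hA.spectral_theorem.symm

lemma fcal_one {A : Matrix I I ℂ} (hA : A.IsHermitian) : fcal (fun _ => 1) A = 1 := by
  rw [fcal_of_isHermitian hA]
  simp

lemma fcal_mul_fcal {A : Matrix I I ℂ} (hA : A.IsHermitian) (f g : ℝ → ℝ) :
    fcal f A * fcal g A = fcal (fun x => f x * g x) A := by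
  simp only [fcal_of_isHermitian hA]
  have hU : star (hA.eigenvectorUnitary : Matrix I I ℂ) *
      (hA.eigenvectorUnitary : Matrix I I ℂ) = 1 := by simp
  simp only [Matrix.mul_assoc]
  congr 1
  rw [← Matrix.mul_assoc (star _), hU, Matrix.one_mul, ← Matrix.mul_assoc,
    Matrix.diagonal_mul_diagonal]
  simp

lemma trace_fcal_mul_fcal {A B : Matrix I I ℂ} (hA : A.IsHermitian) (hB : B.IsHermitian)
    (f g : ℝ → ℝ) :
    ((fcal f A * fcal g B).trace) =
      ((∑ i, ∑ j, f (hA.eigenvalues i) * g (hB.eigenvalues j) * eigenOverlap hA hB i j : ℝ) :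
        ℂ) := by
  rw [fcal_of_isHermitian hA, fcal_of_isHermitian hB]
  simp only [eigenOverlap]
  generalize (hA.eigenvectorUnitary : Matrix I I ℂ) = U
  generalize (hB.eigenvectorUnitary : Matrix I I ℂ) = V
  have h : (U * Matrix.diagonal (fun i => (f (hA.eigenvalues i) : ℂ)) * star U *
      (V * Matrix.diagonal (fun i => (g (hB.eigenvalues i) : ℂ)) * star V)).trace =
      (Matrix.diagonal (fun i => (f (hA.eigenvalues i) : ℂ)) * ((star U * V) *
        (Matrix.diagonal (fun i => (g (hB.eigenvalues i) : ℂ)) * star (star U * V)))).trace := by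
    rw [Matrix.mul_assoc U, Matrix.mul_assoc U, Matrix.trace_mul_comm U]
    simp only [star_mul, star_star, Matrix.mul_assoc]
  rw [h, Matrix.trace]
  push_cast
  refine Finset.sum_congr rfl fun i _ => ?_
  rw [Matrix.diag_apply, Matrix.diagonal_mul, Matrix.mul_apply, Finset.mul_sum]
  refine Finset.sum_congr rfl fun j _ => ?_
  rw [Matrix.diagonal_mul, Matrix.star_apply, Complex.normSq_eq_conj_mul_self]
  simp only [RCLike.star_def]
  ring

lemma sum_eigenOverlap_right {A B : Matrix I I ℂ} (hA : A.IsHermitian) (hB : B.IsHermitian)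
    (i : I) : ∑ j, eigenOverlap hA hB i j = 1 := by
  have h : (star (hA.eigenvectorUnitary : Matrix I I ℂ) *
      (hB.eigenvectorUnitary : Matrix I I ℂ)) * star (star (hA.eigenvectorUnitary : Matrix I I ℂ) *
      (hB.eigenvectorUnitary : Matrix I I ℂ)) = 1 := by
    rw [star_mul, star_star, Matrix.mul_assoc, ← Matrix.mul_assoc _ (star _)]
    simp
  have h' := congrFun (congrFun h i) i
  rw [Matrix.mul_apply, Matrix.one_apply_eq] at h'
  apply Complex.ofReal_injective
  push_cast
  rw [← h']
  refine Finset.sum_congr rfl fun j _ => ?_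
  rw [eigenOverlap, Matrix.star_apply, Complex.normSq_eq_conj_mul_self, mul_comm]
  rfl

lemma trace_eq_sum_mul_eigenOverlap {A B : Matrix I I ℂ} (hA : A.IsHermitian)
    (hB : B.IsHermitian) :
    A.trace = ((∑ i, ∑ j, hA.eigenvalues i * eigenOverlap hA hB i j : ℝ) : ℂ) := by
  have h := trace_fcal_mul_fcal hA hB (fun x => x) (fun _ => 1)
  rw [fcal_id hA, fcal_one hB, mul_one] at h
  simpa using h

lemma trace_eq_sum_mul_eigenOverlap' {A B : Matrix I I ℂ} (hA : A.IsHermitian)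
    (hB : B.IsHermitian) :
    B.trace = ((∑ i, ∑ j, hB.eigenvalues j * eigenOverlap hA hB i j : ℝ) : ℂ) := by
  have h := trace_fcal_mul_fcal hA hB (fun _ => 1) (fun x => x)
  rw [fcal_id hB, fcal_one hA, one_mul] at h
  simpa using h

lemma relEnt_eq_sum {A B : Matrix I I ℂ} (hA : A.IsHermitian) (hB : B.IsHermitian) :
    relEnt A B = ∑ i, ∑ j, eigenOverlap hA hB i j * (hA.eigenvalues i *
      ((if 0 < hA.eigenvalues i then Real.logb 2 (hA.eigenvalues i) else 0) -
        (if 0 < hB.eigenvalues j then Real.logb 2 (hB.eigenvalues j) else 0))) := by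
  have h₁ := trace_fcal_mul_fcal hA hB
    (fun x => x * (if 0 < x then Real.logb 2 x else 0)) (fun _ => 1)
  have h₂ := trace_fcal_mul_fcal hA hB (fun x => x) (fun x => if 0 < x then Real.logb 2 x else 0)
  rw [fcal_one hB, mul_one, ← fcal_mul_fcal hA, fcal_id hA] at h₁
  rw [fcal_id hA] at h₂
  rw [relEnt, Matrix.mul_sub, Matrix.trace_sub, mlog, mlog, h₁, h₂, ← Complex.ofReal_sub,
    Complex.ofReal_re, ← Finset.sum_sub_distrib]
  refine Finset.sum_congr rfl fun i _ => ?_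
  rw [← Finset.sum_sub_distrib]
  refine Finset.sum_congr rfl fun j _ => ?_
  ring

lemma star_eigenvectorUnitary_mul {A : Matrix I I ℂ} (hA : A.IsHermitian) :
    star (hA.eigenvectorUnitary : Matrix I I ℂ) * A =
      Matrix.diagonal (fun i => (hA.eigenvalues i : ℂ)) *
        star (hA.eigenvectorUnitary : Matrix I I ℂ) := by
  have h := (fcal_id hA).symm.trans (fcal_of_isHermitian hA _)
  calc _ = star (hA.eigenvectorUnitary : Matrix I I ℂ) * _ := congrArg _ h
    _ = _ := by
      rw [← Matrix.mul_assoc, ← Matrix.mul_assoc]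
      simp

/-- Quadratic form of a Hermitian matrix in the eigenbasis of another one. -/
lemma star_dotProduct_mulVec_eigenvectorUnitary {A B : Matrix I I ℂ} (hA : A.IsHermitian)
    (hB : B.IsHermitian) (x : I → ℂ) :
    star ((hB.eigenvectorUnitary : Matrix I I ℂ).mulVec x) ⬝ᵥ
      A.mulVec ((hB.eigenvectorUnitary : Matrix I I ℂ).mulVec x) =
    ((∑ i, hA.eigenvalues i * Complex.normSq ((star (hA.eigenvectorUnitary : Matrix I I ℂ) *
      (hB.eigenvectorUnitary : Matrix I I ℂ)).mulVec x i) : ℝ) : ℂ) := by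
  set U := (hA.eigenvectorUnitary : Matrix I I ℂ) with hU
  have hA' : A = U * (Matrix.diagonal (fun i => (hA.eigenvalues i : ℂ)) * star U) := by
    conv_lhs => rw [← fcal_id hA, fcal_of_isHermitian hA, Matrix.mul_assoc]
  rw [← Matrix.mulVec_mulVec x (star U)]
  generalize (hB.eigenvectorUnitary : Matrix I I ℂ).mulVec x = y
  conv_lhs => rw [hA']
  rw [← Matrix.mulVec_mulVec, Matrix.dotProduct_mulVec, ← Matrix.mulVec_mulVec]
  have h : Matrix.vecMul (star y) U = star ((star U).mulVec y) := by
    rw [Matrix.star_mulVec]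
    simp [Matrix.star_eq_conjTranspose]
  rw [h, dotProduct]
  push_cast
  refine Finset.sum_congr rfl fun i _ => ?_
  rw [Matrix.mulVec_diagonal, Complex.normSq_eq_conj_mul_self, Pi.star_apply]
  simp only [RCLike.star_def]
  ring

lemma eigenOverlap_eq_zero {A B : Matrix I I ℂ} (hA : A.IsHermitian) (hB : B.IsHermitian)
    (hAB : SuppLe A B) {i j : I} (hi : hA.eigenvalues i ≠ 0) (hj : hB.eigenvalues j = 0) :
    eigenOverlap hA hB i j = 0 := by
  have h₁ : B.mulVec (hB.eigenvectorBasis j) = 0 := by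
    rw [hB.mulVec_eigenvectorBasis, hj, zero_smul]
  have h₂ := hAB _ h₁
  rw [← hB.eigenvectorUnitary_mulVec] at h₂
  have h₃ : (star (hA.eigenvectorUnitary : Matrix I I ℂ)).mulVec
      (A.mulVec ((hB.eigenvectorUnitary : Matrix I I ℂ).mulVec (Pi.single j 1))) i = 0 := by
    rw [h₂]; simp
  rw [Matrix.mulVec_mulVec, Matrix.mulVec_mulVec,
    star_eigenvectorUnitary_mul, Matrix.mul_assoc, Matrix.mulVec_single_one, Matrix.col_apply,
    Matrix.diagonal_mul] at h₃
  rw [eigenOverlap, Complex.normSq_eq_zero]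
  exact (mul_eq_zero.mp h₃).resolve_left (by exact_mod_cast hi)

end Overlap

section RelativeEntropy

lemma logb_two_le_sub_one_div {x : ℝ} (hx : 0 < x) :
    Real.logb 2 x ≤ (x - 1) / Real.log 2 := by
  rw [Real.logb]
  have := Real.log_le_sub_one_of_pos hx
  have := Real.log_pos one_lt_two
  gcongr

/-- **Klein's inequality** for states. -/
theorem relEnt_nonneg {ρ ω : Matrix I I ℂ} (hρ : IsState ρ) (hω : IsState ω)
    (h : SuppLe ρ ω) : 0 ≤ relEnt ρ ω := by
  have hA := hρ.1.isHermitian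
  have hB := hω.1.isHermitian
  have hlog := Real.log_pos one_lt_two
  have tρ : ∑ i, ∑ j, hA.eigenvalues i * eigenOverlap hA hB i j = 1 := by
    exact_mod_cast (trace_eq_sum_mul_eigenOverlap hA hB).symm.trans hρ.2
  have tω : ∑ i, ∑ j, hB.eigenvalues j * eigenOverlap hA hB i j = 1 := by
    exact_mod_cast (trace_eq_sum_mul_eigenOverlap' hA hB).symm.trans hω.2
  rw [relEnt_eq_sum hA hB]
  calc (0 : ℝ) = (∑ i, ∑ j, hA.eigenvalues i * eigenOverlap hA hB i j -
        ∑ i, ∑ j, hB.eigenvalues j * eigenOverlap hA hB i j) / Real.log 2 := by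
        rw [tρ, tω]; simp
    _ = ∑ i, ∑ j, eigenOverlap hA hB i j *
          ((hA.eigenvalues i - hB.eigenvalues j) / Real.log 2) := by
        simp only [← Finset.sum_sub_distrib, Finset.sum_div]
        refine Finset.sum_congr rfl fun i _ => Finset.sum_congr rfl fun j _ => ?_
        ring
    _ ≤ _ := by
        refine Finset.sum_le_sum fun i _ => Finset.sum_le_sum fun j _ => ?_
        have hp := hρ.1.eigenvalues_nonneg i
        have hq := hω.1.eigenvalues_nonneg j
        rcases hp.eq_or_lt with hp | hp
        · rw [← hp]
          simp only [zero_sub, zero_mul, mul_zero]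
          exact mul_nonpos_of_nonneg_of_nonpos (eigenOverlap_nonneg hA hB i j)
            (div_nonpos_of_nonpos_of_nonneg (by linarith) hlog.le)
        rcases hq.eq_or_lt with hq | hq
        · rw [eigenOverlap_eq_zero hA hB h hp.ne' hq.symm]
          simp
        refine mul_le_mul_of_nonneg_left ?_ (eigenOverlap_nonneg hA hB i j)
        rw [if_pos hp, if_pos hq]
        have h1 := mul_le_mul_of_nonneg_left (logb_two_le_sub_one_div (div_pos hq hp)) hp.le
        rw [Real.logb_div hq.ne' hp.ne'] at h1
        have h2 : hA.eigenvalues i * ((hB.eigenvalues j / hA.eigenvalues i - 1) / Real.log 2) =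
            -((hA.eigenvalues i - hB.eigenvalues j) / Real.log 2) := by
          field_simp
          ring
        rw [h2] at h1
        linarith

lemma suppLe_of_posSemidef_smul_sub {J : Type*} [Fintype J] {ρ ω : Matrix J J ℂ}
    (hρ : ρ.PosSemidef) {c : ℝ} (h : (c • ω - ρ).PosSemidef) : SuppLe ρ ω := by
  intro v hv
  have h₁ := h.dotProduct_mulVec_nonneg v
  rw [Matrix.sub_mulVec, Matrix.smul_mulVec, hv, smul_zero, zero_sub, dotProduct_neg] at h₁
  exact (hρ.dotProduct_mulVec_zero_iff v).mp
    (le_antisymm (neg_nonneg.mp h₁) (hρ.dotProduct_mulVec_nonneg v))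

/-- If `ρ ≤ c ω`, then every eigenvalue `p` of `ρ` with eigenvector `e` satisfies
`p ⟨e, ω⁻¹ e⟩ ≤ c`. -/
lemma eigenvalue_mul_sum_inv_le {ρ ω : Matrix I I ℂ} (hρ : ρ.PosSemidef) (hω : ω.PosSemidef)
    {c : ℝ} (hc : 0 ≤ c) (h : (c • ω - ρ).PosSemidef) (i : I) :
    hρ.isHermitian.eigenvalues i * ∑ j, (hω.isHermitian.eigenvalues j)⁻¹ *
      eigenOverlap hρ.isHermitian hω.isHermitian i j ≤ c := by
  have hA := hρ.isHermitian
  have hB := hω.isHermitian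
  set s := ∑ j, (hB.eigenvalues j)⁻¹ * eigenOverlap hA hB i j with hs
  set W := star (hA.eigenvectorUnitary : Matrix I I ℂ) * (hB.eigenvectorUnitary : Matrix I I ℂ)
    with hW
  let x : I → ℂ := fun j => (((hB.eigenvalues j)⁻¹ : ℝ) : ℂ) * star (W i j)
  have hx := h.dotProduct_mulVec_nonneg ((hB.eigenvectorUnitary : Matrix I I ℂ).mulVec x)
  rw [Matrix.sub_mulVec, Matrix.smul_mulVec, dotProduct_sub, dotProduct_smul,
    star_dotProduct_mulVec_eigenvectorUnitary hA hB,
    star_dotProduct_mulVec_eigenvectorUnitary hB hB, Complex.real_smul, ← Complex.ofReal_mul,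
    ← Complex.ofReal_sub, Complex.zero_le_real, sub_nonneg, ← hW] at hx
  have hWx : W.mulVec x i = (s : ℂ) := by
    rw [Matrix.mulVec, dotProduct, hs]
    push_cast
    refine Finset.sum_congr rfl fun j _ => ?_
    rw [eigenOverlap, Complex.normSq_eq_conj_mul_self, ← hW]
    simp only [x, RCLike.star_def]
    push_cast
    ring
  have hBx : ∑ j, hB.eigenvalues j * Complex.normSq
      ((star (hB.eigenvectorUnitary : Matrix I I ℂ) *
        (hB.eigenvectorUnitary : Matrix I I ℂ)).mulVec x j) = s := by
    rw [hs]
    refine Finset.sum_congr rfl fun j _ => ?_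
    have hone : star (hB.eigenvectorUnitary : Matrix I I ℂ) *
      (hB.eigenvectorUnitary : Matrix I I ℂ) = 1 := by simp
    rw [hone, Matrix.one_mulVec, eigenOverlap, ← hW]
    simp only [x, Complex.normSq_mul, Complex.normSq_ofReal, RCLike.star_def, Complex.normSq_conj]
    rcases eq_or_ne (hB.eigenvalues j) 0 with h0 | h0
    · simp [h0]
    · field_simp
  have hle : hA.eigenvalues i * (s * s) ≤ c * s := by
    rw [hBx] at hx
    refine le_trans ?_ hx
    have := Finset.single_le_sum (f := fun i => hA.eigenvalues i * Complex.normSq (W.mulVec x i))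
      (fun i _ => mul_nonneg (hρ.eigenvalues_nonneg i) (Complex.normSq_nonneg _))
      (Finset.mem_univ i)
    simpa only [hWx, Complex.normSq_ofReal] using this
  have hs0 : 0 ≤ s := Finset.sum_nonneg fun j _ =>
    mul_nonneg (inv_nonneg.mpr (hω.eigenvalues_nonneg j)) (eigenOverlap_nonneg hA hB i j)
  rcases hs0.eq_or_lt with h0 | h0
  · rw [← h0, mul_zero]; exact hc
  · refine le_of_mul_le_mul_right ?_ h0
    linarith

/-- The relative entropy is at most the max-relative entropy. -/
theorem relEnt_le_logb_of_posSemidef_smul_sub {ρ ω : Matrix I I ℂ} (hρ : IsState ρ)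
    (hω : ω.PosSemidef) {c : ℝ} (hc : 0 < c) (h : (c • ω - ρ).PosSemidef) :
    relEnt ρ ω ≤ Real.logb 2 c := by
  have hA := hρ.1.isHermitian
  have hB := hω.isHermitian
  have hlog := Real.log_pos one_lt_two
  have hsupp := suppLe_of_posSemidef_smul_sub hρ.1 h
  have tρ : ∑ i, hA.eigenvalues i = 1 := by
    apply Complex.ofReal_injective
    push_cast
    exact hA.trace_eq_sum_eigenvalues.symm.trans hρ.2
  rw [relEnt_eq_sum hA hB]
  calc _ ≤ ∑ i, hA.eigenvalues i * ∑ j, eigenOverlap hA hB i j * (Real.logb 2 c +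
        (hA.eigenvalues i * (hB.eigenvalues j)⁻¹ / c - 1) / Real.log 2) := by
        refine Finset.sum_le_sum fun i _ => ?_
        rw [Finset.mul_sum]
        refine Finset.sum_le_sum fun j _ => ?_
        have hp := hρ.1.eigenvalues_nonneg i
        have hq := hω.eigenvalues_nonneg j
        rcases hp.eq_or_lt with hp | hp
        · rw [← hp]
          simp
        rcases hq.eq_or_lt with hq | hq
        · rw [eigenOverlap_eq_zero hA hB hsupp hp.ne' hq.symm]
          simp
        rw [mul_left_comm]
        refine mul_le_mul_of_nonneg_left (mul_le_mul_of_nonneg_left ?_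
          (eigenOverlap_nonneg hA hB i j)) hp.le
        rw [if_pos hp, if_pos hq]
        have h1 := logb_two_le_sub_one_div (div_pos (mul_pos hp (inv_pos.mpr hq)) hc)
        rw [Real.logb_div (mul_pos hp (inv_pos.mpr hq)).ne' hc.ne',
          Real.logb_mul hp.ne' (inv_pos.mpr hq).ne', Real.logb_inv] at h1
        linarith
    _ ≤ ∑ i, hA.eigenvalues i * Real.logb 2 c := by
        refine Finset.sum_le_sum fun i _ =>
          mul_le_mul_of_nonneg_left ?_ (hρ.1.eigenvalues_nonneg i)
        have h1 := eigenvalue_mul_sum_inv_le hρ.1 hω hc.le h i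
        have h2 : ∑ j, eigenOverlap hA hB i j * (Real.logb 2 c +
            (hA.eigenvalues i * (hB.eigenvalues j)⁻¹ / c - 1) / Real.log 2) =
            (Real.logb 2 c - 1 / Real.log 2) * ∑ j, eigenOverlap hA hB i j +
            (hA.eigenvalues i * ∑ j, (hB.eigenvalues j)⁻¹ * eigenOverlap hA hB i j) / c /
              Real.log 2 := by
          simp only [Finset.mul_sum, Finset.sum_div, ← Finset.sum_add_distrib]
          refine Finset.sum_congr rfl fun j _ => ?_
          ring
        rw [h2, sum_eigenOverlap_right, mul_one]
        have h3 : (hA.eigenvalues i * ∑ j, (hB.eigenvalues j)⁻¹ * eigenOverlap hA hB i j) / c /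
            Real.log 2 ≤ 1 / Real.log 2 :=
          div_le_div_of_nonneg_right ((div_le_one hc).mpr h1) hlog.le
        linarith
    _ = Real.logb 2 c := by rw [← Finset.sum_mul, tρ, one_mul]

end RelativeEntropy

section Extension

variable {A B : Type*}

/-- The operator `ρ_{A B_i} ⊗ |b₀⟩⟨b₀|^{⊗(k-1)}` on `A ⊗ B^{⊗k}`. -/
def placeAt [DecidableEq B]
    {k : ℕ} (b₀ : B) (ρ : Matrix (A × B) (A × B) ℂ) (i : Fin k) :
    Matrix (A × (Fin k → B)) (A × (Fin k → B)) ℂ :=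
  fun p q => ρ (p.1, p.2 i) (q.1, q.2 i) *
    vecOp (fun r : A × (Fin k → B) => if ∀ j, j ≠ i → r.2 j = b₀ then 1 else 0) p q

lemma posSemidef_placeAt [Finite A] [Finite B] [DecidableEq B]
    {k : ℕ} (b₀ : B) {ρ : Matrix (A × B) (A × B) ℂ} (hρ : ρ.PosSemidef)
    (i : Fin k) : (placeAt b₀ ρ i).PosSemidef :=
  (hρ.submatrix fun p : A × (Fin k → B) => (p.1, p.2 i)).hadamard
    (Matrix.posSemidef_vecMulVec_self_star
      (fun r : A × (Fin k → B) => if ∀ j, j ≠ i → r.2 j = b₀ then (1 : ℂ) else 0))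

lemma trace_placeAt [Fintype A] [Fintype B] [DecidableEq B]
    {k : ℕ} (b₀ : B) (ρ : Matrix (A × B) (A × B) ℂ) (i : Fin k) :
    (placeAt b₀ ρ i).trace = ρ.trace := by
  simp only [Matrix.trace, Matrix.diag_apply, Fintype.sum_prod_type]
  refine Finset.sum_congr rfl fun a _ => ?_
  rw [← (Equiv.funSplitAt i B).symm.sum_comp, Fintype.sum_prod_type]
  refine Finset.sum_congr rfl fun b _ => ?_
  rw [Finset.sum_eq_single (fun _ => b₀)]
  · simp +contextual [placeAt, vecOp]
  · intro f _ hf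
    have : ¬ ∀ j, j ≠ i → (Equiv.funSplitAt i B).symm (b, f) j = b₀ := by
      intro h
      refine hf (funext fun j => ?_)
      have := h j j.2
      simpa [j.2] using this
    simp only [placeAt, vecOp, if_neg this, zero_mul, mul_zero]
  · simp

lemma placeAt_comp_perm [DecidableEq B]
    {k : ℕ} (b₀ : B) (ρ : Matrix (A × B) (A × B) ℂ) (i : Fin k)
    (π : Equiv.Perm (Fin k)) (p q : A × (Fin k → B)) :
    placeAt b₀ ρ i (p.1, p.2 ∘ π) (q.1, q.2 ∘ π) = placeAt b₀ ρ (π i) p q := by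
  have h : ∀ f : Fin k → B, (∀ j, j ≠ i → f (π j) = b₀) ↔ ∀ j, j ≠ π i → f j = b₀ := by
    intro f
    rw [π.forall_congr_left]
    simp [Equiv.symm_apply_eq]
  simp only [placeAt, vecOp, Function.comp_apply, h]

/-- Partial trace over all but the first `B`-factor of an operator on `A ⊗ B^{⊗k}`. -/
def traceTail [Fintype B]
    {k : ℕ} (σ : Matrix (A × (Fin k → B)) (A × (Fin k → B)) ℂ) :
    Matrix (A × B) (A × B) ℂ :=
  fun p q => ∑ f : {i : Fin k // (i : ℕ) ≠ 0} → B,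
    σ (p.1, fun i => if h : (i : ℕ) = 0 then p.2 else f ⟨i, h⟩)
      (q.1, fun i => if h : (i : ℕ) = 0 then q.2 else f ⟨i, h⟩)

lemma traceTail_sum [Fintype B]
    {k : ℕ} {ι : Type*} (s : Finset ι)
    (σ : ι → Matrix (A × (Fin k → B)) (A × (Fin k → B)) ℂ) :
    traceTail (∑ i ∈ s, σ i) = ∑ i ∈ s, traceTail (σ i) := by
  ext p q
  simp only [traceTail, Matrix.sum_apply]
  exact Finset.sum_comm

lemma posSemidef_traceTail [Fintype B]
    {k : ℕ} {σ : Matrix (A × (Fin k → B)) (A × (Fin k → B)) ℂ}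
    (hσ : σ.PosSemidef) : (traceTail σ).PosSemidef := by
  have h : traceTail σ = ∑ f : {i : Fin k // (i : ℕ) ≠ 0} → B,
      σ.submatrix (fun p : A × B => (p.1, fun i => if h : (i : ℕ) = 0 then p.2 else f ⟨i, h⟩))
        (fun p : A × B => (p.1, fun i => if h : (i : ℕ) = 0 then p.2 else f ⟨i, h⟩)) := by
    ext p q
    simp [traceTail, Matrix.sum_apply]
  rw [h]
  exact Matrix.posSemidef_sum _ fun f _ => hσ.submatrix _

lemma trace_traceTail [Fintype A] [Fintype B]
    {k : ℕ} (hk : 1 ≤ k) (σ : Matrix (A × (Fin k → B)) (A × (Fin k → B)) ℂ) :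
    (traceTail σ).trace = σ.trace := by
  let e : B × ({i : Fin k // (i : ℕ) ≠ 0} → B) ≃ (Fin k → B) :=
    { toFun := fun x i => if h : (i : ℕ) = 0 then x.1 else x.2 ⟨i, h⟩
      invFun := fun f => (f ⟨0, hk⟩, fun i => f i)
      left_inv := fun x => by
        ext i
        · simp
        · simp [i.2]
      right_inv := fun f => by
        funext i
        by_cases h : (i : ℕ) = 0
        · have : i = ⟨0, hk⟩ := Fin.ext h
          simp [this]
        · simp [h] }
  simp only [Matrix.trace, Matrix.diag_apply, Fintype.sum_prod_type]
  refine Finset.sum_congr rfl fun a _ => ?_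
  rw [← e.sum_comp, Fintype.sum_prod_type]
  rfl

lemma traceTail_placeAt_zero [Fintype B] [DecidableEq B]
    {k : ℕ} (hk : 1 ≤ k) (b₀ : B) (ρ : Matrix (A × B) (A × B) ℂ) :
    traceTail (placeAt b₀ ρ (⟨0, hk⟩ : Fin k)) = ρ := by
  ext p q
  rw [traceTail, Finset.sum_eq_single (fun _ => b₀)]
  · simp +contextual [placeAt, vecOp, Fin.ext_iff]
  · intro f _ hf
    have : ¬ ∀ j : Fin k, j ≠ ⟨0, hk⟩ →
        (if h : (j : ℕ) = 0 then p.2 else f ⟨j, h⟩) = b₀ := by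
      intro h
      refine hf (funext fun j => ?_)
      have := h j (fun h0 => j.2 (by rw [h0]))
      simpa [j.2] using this
    simp only [placeAt, vecOp, if_neg this, zero_mul, mul_zero]
  · simp

/-- Every bipartite state is dominated by `k` times a `k`-extendible state. -/
theorem exists_isKExtendible_posSemidef_sub [Fintype A] [Fintype B]
    {k : ℕ} (hk : 1 ≤ k) {ρ : Matrix (A × B) (A × B) ℂ}
    (hρ : IsState ρ) : ∃ ω : Matrix (A × B) (A × B) ℂ,
      IsState ω ∧ IsKExtendible k ω ∧ ((k : ℝ) • ω - ρ).PosSemidef := by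
  classical
  have hB : Nonempty B := by
    by_contra hB
    rw [not_nonempty_iff] at hB
    have := hρ.2
    simp [Matrix.trace] at this
  obtain ⟨b₀⟩ := hB
  have hk' : (k : ℝ) ≠ 0 := by positivity
  set τ : Matrix (A × (Fin k → B)) (A × (Fin k → B)) ℂ := ∑ i, placeAt b₀ ρ i with hτ
  have hσ : IsState (((k : ℝ)⁻¹) • τ) := by
    refine ⟨(Matrix.posSemidef_sum _ fun i _ => posSemidef_placeAt b₀ hρ.1 i).smul
      (by positivity), ?_⟩
    rw [Matrix.trace_smul, hτ, Matrix.trace_sum]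
    simp [trace_placeAt, hρ.2, Complex.real_smul, show (k : ℂ) ≠ 0 by exact_mod_cast hk']
  refine ⟨traceTail ((k : ℝ)⁻¹ • τ), ⟨posSemidef_traceTail hσ.1, ?_⟩,
    ⟨_, hσ, fun π p q => ?_, fun p q => rfl⟩, ?_⟩
  · rw [trace_traceTail hk, hσ.2]
  · simp only [hτ, Matrix.smul_apply, Matrix.sum_apply, placeAt_comp_perm]
    rw [Equiv.sum_comp π fun i => placeAt b₀ ρ i p q]
  · have h : (k : ℝ) • traceTail ((k : ℝ)⁻¹ • τ) = traceTail τ := by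
      ext p q
      simp only [traceTail, Matrix.smul_apply, ← Finset.smul_sum]
      rw [smul_inv_smul₀ hk']
    rw [h, hτ, traceTail_sum, ← Finset.add_sum_erase _ _ (Finset.mem_univ (⟨0, hk⟩ : Fin k)),
      traceTail_placeAt_zero, add_sub_cancel_left]
    exact Matrix.posSemidef_sum _ fun i _ => posSemidef_traceTail (posSemidef_placeAt b₀ hρ.1 i)

lemma isState_tpowBi [Fintype A] [Fintype B]
    {ρ : Matrix (A × B) (A × B) ℂ} (hρ : IsState ρ) (n : ℕ) :
    IsState (tpowBi ρ n) := by
  classical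
  constructor
  · have h : ∀ s : Finset (Fin n), Matrix.PosSemidef
        (fun x y : (Fin n → A) × (Fin n → B) => ∏ i ∈ s, ρ (x.1 i, x.2 i) (y.1 i, y.2 i)) := by
      intro s
      induction s using Finset.induction_on with
      | empty =>
        refine (congrArg Matrix.PosSemidef ?_).mpr (Matrix.posSemidef_vecMulVec_self_star
          (fun _ : (Fin n → A) × (Fin n → B) => (1 : ℂ)))
        ext x y
        simp [Matrix.vecMulVec_apply]
      | insert i s hi ih =>
        refine (congrArg Matrix.PosSemidef ?_).mpr ((hρ.1.submatrix
          fun x : (Fin n → A) × (Fin n → B) => (x.1 i, x.2 i)).hadamard ih)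
        ext x y
        exact Finset.prod_insert hi
    exact h Finset.univ
  · rw [Matrix.trace, ← (Equiv.arrowProdEquivProdArrow (Fin n) (fun _ => A) (fun _ => B)).sum_comp]
    have h := Finset.prod_univ_sum (fun _ : Fin n => (Finset.univ : Finset (A × B)))
      (fun _ p => ρ p p)
    rw [Fintype.piFinset_univ] at h
    refine Eq.trans (Eq.trans ?_ h.symm) ?_
    · rfl
    · have := hρ.2
      simp only [Matrix.trace, Matrix.diag_apply] at this
      simp [this]

/-- Every state admits a `k`-extendible state at relative entropy at most `log₂ k`. -/
theorem exists_isKExtendible_relEnt_le [DecidableEq A] [Fintype A] [Fintype B] [DecidableEq B]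
    {k : ℕ} (hk : 1 ≤ k)
    {ρ : Matrix (A × B) (A × B) ℂ} (hρ : IsState ρ) : ∃ ω : Matrix (A × B) (A × B) ℂ,
      IsState ω ∧ IsKExtendible k ω ∧ ((k : ℝ) • ω - ρ).PosSemidef ∧
      SuppLe ρ ω ∧ relEnt ρ ω ≤ Real.logb 2 k := by
  obtain ⟨ω, hω, hext, hle⟩ := exists_isKExtendible_posSemidef_sub hk hρ
  exact ⟨ω, hω, hext, hle, suppLe_of_posSemidef_smul_sub hρ.1 hle,
    relEnt_le_logb_of_posSemidef_smul_sub hρ hω.1 (by positivity) hle⟩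

/-- The relative entropy distance to the `k`-extendible states lies in `[0, log₂ k]`. -/
theorem sInf_relEnt_isKExtendible_mem_Icc [DecidableEq A] [Fintype A] [Fintype B] [DecidableEq B]
    {k : ℕ} (hk : 1 ≤ k)
    {ρ : Matrix (A × B) (A × B) ℂ} (hρ : IsState ρ) :
    sInf {x : ℝ | ∃ ω, IsState ω ∧ IsKExtendible k ω ∧ SuppLe ρ ω ∧ x = relEnt ρ ω} ∈
      Set.Icc 0 (Real.logb 2 k) := by
  have hnonneg : ∀ x ∈ {x : ℝ | ∃ ω, IsState ω ∧ IsKExtendible k ω ∧ SuppLe ρ ω ∧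
      x = relEnt ρ ω}, 0 ≤ x := by
    rintro x ⟨ω, hω, -, hs, rfl⟩
    exact relEnt_nonneg hρ hω hs
  obtain ⟨ω, hω, hext, -, hs, hle⟩ := exists_isKExtendible_relEnt_le hk hρ
  exact ⟨Real.sInf_nonneg hnonneg,
    (csInf_le ⟨0, hnonneg⟩ ⟨ω, hω, hext, hs, rfl⟩).trans hle⟩

end Extension

/-- **k-extendible states trivialize the regularized relative entropy.**  For every
bipartite state `ρ` and `k ≥ 1` there is a `k`-extendible state `ω` with `ρ ≤ k ω`
and `S(ρ‖ω) ≤ log₂ k`, so `inf {S(ρ‖ω) : ω k-extendible} ≤ log₂ k`; moreover the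
regularized relative entropy to the `k`-extendible sets is `0` for every state. -/
theorem extendible_regularized_zero {a b : ℕ} (k : ℕ) (hk : 1 ≤ k)
    (ρ : Matrix (Fin a × Fin b) (Fin a × Fin b) ℂ) (hρ : IsState ρ) :
    (∃ ω : Matrix (Fin a × Fin b) (Fin a × Fin b) ℂ,
      IsState ω ∧ IsKExtendible k ω ∧ (((k : ℝ) • ω - ρ).PosSemidef) ∧
      SuppLe ρ ω ∧ relEnt ρ ω ≤ Real.logb 2 k) ∧
    sInf {x : ℝ | ∃ ω, IsState ω ∧ IsKExtendible k ω ∧ SuppLe ρ ω ∧ x = relEnt ρ ω}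
      ≤ Real.logb 2 k ∧
    Filter.Tendsto (fun n : ℕ =>
        sInf {x : ℝ | ∃ ω, IsState ω ∧ IsKExtendible k ω ∧ SuppLe (tpowBi ρ n) ω ∧
          x = relEnt (tpowBi ρ n) ω} / n)
      Filter.atTop (nhds 0) := by
  refine ⟨exists_isKExtendible_relEnt_le hk hρ, (sInf_relEnt_isKExtendible_mem_Icc hk hρ).2, ?_⟩
  have h := fun n => sInf_relEnt_isKExtendible_mem_Icc hk (isState_tpowBi hρ n)
  exact squeeze_zero (fun n => div_nonneg (h n).1 n.cast_nonneg)
    (fun n => div_le_div_of_nonneg_right (h n).2 n.cast_nonneg)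
    (tendsto_const_div_atTop_nhds_zero_nat _)
end GQSL
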